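/- Let α > -1/2, let 1 ≤ q ≤ 2, and let p be the conjugate exponent of q (so 1/p + 1/q = 1, with the convention 1/(2p) = 0 when p = ∞). Then there exists a constant C > 0 such that for all r > 0, Σ_{n=0}^∞ r^{qn} / (d_n(α))^q ≤ C · (e^r / r^{α + 1/2 + 1/(2p)})^q. -/

import Mathlib

/-- `d_n(α) = 2^n ⌊n/2⌋! Γ(⌊(n+1)/2⌋ + α + 1) / Γ(α+1)`. -/
noncomputable def dunklD (α : ℝ) (n : ℕ) : ℝ :=
  2 ^ n * (Nat.factorial (n / 2)) *
    Real.Gamma ((((n + 1) / 2 : ℕ) : ℝ) + α + 1) / Real.Gamma (α + 1)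

lemma dunklD_zero (α : ℝ) (hα : -1/2 < α) : dunklD α 0 = 1 := by
  have hΓ : Real.Gamma (α + 1) ≠ 0 := (Real.Gamma_pos_of_pos (by linarith)).ne'
  simp [dunklD, hΓ]

lemma dunklD_even_succ (α : ℝ) (hα : -1/2 < α) (m : ℕ) :
    dunklD α (2 * m + 1) = dunklD α (2 * m) * (2 * m + 2 * α + 2) := by
  have h1 : (2 * m + 1) / 2 = m := by omega
  have h2 : (2 * m + 1 + 1) / 2 = m + 1 := by omega
  have h3 : 2 * m / 2 = m := by omega
  have hne : (m : ℝ) + α + 1 ≠ 0 := by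
    have : (0 : ℝ) ≤ m := m.cast_nonneg
    linarith
  have hΓ : Real.Gamma (m + 1 + α + 1) = (m + α + 1) * Real.Gamma (m + α + 1) := by
    rw [← Real.Gamma_add_one hne]
    ring_nf
  simp only [dunklD, h1, h2, h3]
  push_cast
  rw [hΓ]
  ring

lemma dunklD_odd_succ (α : ℝ) (m : ℕ) :
    dunklD α (2 * m + 2) = dunklD α (2 * m + 1) * (2 * m + 2) := by
  have h1 : (2 * m + 1) / 2 = m := by omega
  have h2 : (2 * m + 1 + 1) / 2 = m + 1 := by omega
  have h4 : (2 * m + 2 + 1) / 2 = m + 1 := by omega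
  simp only [dunklD, h1, h2, h4, Nat.factorial_succ]
  push_cast
  ring

lemma dunklD_pos (α : ℝ) (hα : -1/2 < α) (n : ℕ) : 0 < dunklD α n := by
  have h1 : 0 < Real.Gamma (α + 1) := Real.Gamma_pos_of_pos (by linarith)
  have h2 : 0 < Real.Gamma ((((n + 1) / 2 : ℕ) : ℝ) + α + 1) := by
    apply Real.Gamma_pos_of_pos
    have : (0 : ℝ) ≤ (((n + 1) / 2 : ℕ) : ℝ) := Nat.cast_nonneg _
    linarith
  unfold dunklD
  positivity

lemma dunklD_add_one (α : ℝ) (hα : -1/2 < α) (n : ℕ) :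
    dunklD (α + 1) n = dunklD α n * ((((n + 1) / 2 : ℕ) : ℝ) + α + 1) / (α + 1) := by
  have hne : (((n + 1) / 2 : ℕ) : ℝ) + α + 1 ≠ 0 := by
    have : (0 : ℝ) ≤ (((n + 1) / 2 : ℕ) : ℝ) := Nat.cast_nonneg _
    linarith
  have hne' : α + 1 ≠ 0 := by linarith
  have hΓ : Real.Gamma (α + 1) ≠ 0 := (Real.Gamma_pos_of_pos (by linarith)).ne'
  unfold dunklD
  rw [← add_assoc (((n + 1) / 2 : ℕ) : ℝ) α 1, Real.Gamma_add_one hne, Real.Gamma_add_one hne']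
  field_simp

/-- Bernoulli's inequality for exponents in `[0, 1]`, with denominators cleared. -/
lemma mul_add_two_rpow_le {x β : ℝ} (hx : 0 < x) (h0 : 0 ≤ β) (h1 : β ≤ 1) :
    x * (x + 2) ^ β ≤ x ^ β * (x + 2 * β) := by
  have hs : (0 : ℝ) ≤ 2 / x := by positivity
  have hB := rpow_one_add_le_one_add_mul_self (s := 2 / x) (by linarith) h0 h1
  have h2 : x + 2 = x * (1 + 2 / x) := by field_simp
  rw [h2, Real.mul_rpow hx.le (by positivity)]
  calc x * (x ^ β * (1 + 2 / x) ^ β) ≤ x * (x ^ β * (1 + β * (2 / x))) := by gcongr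
    _ = x ^ β * (x + 2 * β) := by field_simp

lemma factorial_mul_rpow_le_dunklD_even (α : ℝ) (hα : -1/2 < α) (hα' : α ≤ 1/2) (m : ℕ) :
    ((2 * m).factorial : ℝ) * (2 * m + 1) ^ (α + 1/2) ≤ dunklD α (2 * m) := by
  induction m with
  | zero => simp [dunklD_zero α hα]
  | succ m ih =>
    have hB := mul_add_two_rpow_le (x := 2 * m + 1) (β := α + 1/2) (by positivity)
      (by linarith) (by linarith)
    have hf : ((2 * (m + 1)).factorial : ℝ) = (2 * m + 2) * ((2 * m + 1) * (2 * m).factorial) := by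
      rw [show 2 * (m + 1) = 2 * m + 1 + 1 by ring, Nat.factorial_succ, Nat.factorial_succ]
      push_cast
      ring
    have hp : (0 : ℝ) ≤ 2 * m + 2 * α + 2 := by
      have : (0 : ℝ) ≤ m := m.cast_nonneg
      linarith
    rw [hf, show 2 * (m + 1) = 2 * m + 2 by ring, dunklD_odd_succ, dunklD_even_succ α hα]
    push_cast
    calc (2 * (m : ℝ) + 2) * ((2 * m + 1) * (2 * m).factorial) * (2 * (m + 1) + 1) ^ (α + 1/2)
        = (2 * m + 2) * (2 * m).factorial * ((2 * m + 1) * (2 * m + 1 + 2) ^ (α + 1/2)) := by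
          rw [show 2 * ((m : ℝ) + 1) + 1 = 2 * m + 1 + 2 by ring]
          ring
      _ ≤ (2 * m + 2) * (2 * m).factorial *
          ((2 * m + 1) ^ (α + 1/2) * (2 * m + 1 + 2 * (α + 1/2))) := by gcongr
      _ = (2 * m).factorial * (2 * m + 1) ^ (α + 1/2) * (2 * m + 2 * α + 2) * (2 * m + 2) := by
          ring
      _ ≤ _ := by gcongr

lemma factorial_mul_rpow_le_dunklD (α : ℝ) (hα : -1/2 < α) (hα' : α ≤ 1/2) (n : ℕ) :
    (n.factorial : ℝ) * (n + 1) ^ (α + 1/2) ≤ dunklD α n := by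
  obtain ⟨m, rfl | rfl⟩ := n.even_or_odd'
  · exact_mod_cast factorial_mul_rpow_le_dunklD_even α hα hα' m
  · have hE := factorial_mul_rpow_le_dunklD_even α hα hα' m
    have hB := mul_add_two_rpow_le (x := 2 * m + 1) (β := α + 1/2) (by positivity)
      (by linarith) (by linarith)
    have hβ : 0 ≤ α + 1/2 := by linarith
    have hp : (0 : ℝ) ≤ 2 * m + 2 * α + 2 := by
      have : (0 : ℝ) ≤ m := m.cast_nonneg
      linarith
    rw [dunklD_even_succ α hα, Nat.factorial_succ]
    push_cast
    calc (2 * (m : ℝ) + 1) * (2 * m).factorial * (2 * m + 1 + 1) ^ (α + 1/2)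
        ≤ (2 * (m : ℝ) + 1) * (2 * m).factorial * (2 * m + 1 + 2) ^ (α + 1/2) := by
          gcongr
          norm_num
      _ = (2 * m).factorial * ((2 * m + 1) * (2 * m + 1 + 2) ^ (α + 1/2)) := by ring
      _ ≤ (2 * m).factorial * ((2 * m + 1) ^ (α + 1/2) * (2 * m + 1 + 2 * (α + 1/2))) := by gcongr
      _ = (2 * m).factorial * (2 * m + 1) ^ (α + 1/2) * (2 * m + 2 * α + 2) := by ring
      _ ≤ _ := by gcongr

lemma exists_factorial_mul_rpow_le_dunklD (α : ℝ) (hα : -1/2 < α) :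
    ∃ c : ℝ, 0 < c ∧ ∀ n : ℕ, c * (n.factorial * (n + 1) ^ (α + 1/2)) ≤ dunklD α n := by
  obtain ⟨N, hN⟩ := exists_nat_ge (α - 1/2)
  induction N generalizing α with
  | zero =>
    exact ⟨1, one_pos, fun n => by
      simpa using factorial_mul_rpow_le_dunklD α hα (by push_cast at hN; linarith) n⟩
  | succ N ih =>
    by_cases hle : α ≤ 1/2
    · exact ⟨1, one_pos, fun n => by simpa using factorial_mul_rpow_le_dunklD α hα hle n⟩
    push Not at hle
    obtain ⟨c, hc, h⟩ := ih (α - 1) (by linarith) (by push_cast at hN; linarith)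
    have hα0 : 0 < α := by linarith
    refine ⟨c * (1 / (2 * α)), by positivity, fun n => ?_⟩
    have hrec := dunklD_add_one (α - 1) (by linarith) n
    rw [sub_add_cancel] at hrec
    have hfloor : (n : ℝ) ≤ 2 * (((n + 1) / 2 : ℕ) : ℝ) := by
      have : n ≤ 2 * ((n + 1) / 2) := by omega
      exact_mod_cast this
    have hlin : ((n : ℝ) + 1) / 2 ≤ (((n + 1) / 2 : ℕ) : ℝ) + (α - 1) + 1 := by linarith
    have hpow : ((n : ℝ) + 1) ^ (α + 1/2) = (n + 1) ^ (α - 1 + 1/2) * (n + 1) := by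
      rw [← Real.rpow_add_one (by positivity)]
      ring_nf
    rw [hrec, hpow]
    calc c * (1 / (2 * α)) * (n.factorial * (((n : ℝ) + 1) ^ (α - 1 + 1/2) * (n + 1)))
        = c * (n.factorial * ((n : ℝ) + 1) ^ (α - 1 + 1/2)) * ((n + 1) / 2) / α := by
          field_simp
      _ ≤ dunklD (α - 1) n * ((((n + 1) / 2 : ℕ) : ℝ) + (α - 1) + 1) / α := by
          have := dunklD_pos (α - 1) (by linarith) n
          gcongr
          exact h n

lemma rpow_le_one_add_pow {x β : ℝ} {k : ℕ} (hx : 0 ≤ x) (hβ : 0 ≤ β) (hk : β ≤ k) :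
    x ^ β ≤ 1 + x ^ k := by
  rcases le_total x 1 with h | h
  · have := Real.rpow_le_one hx h hβ
    have : 0 ≤ x ^ k := by positivity
    linarith
  · have := Real.rpow_le_rpow_of_exponent_le h hk
    rw [Real.rpow_natCast] at this
    linarith

lemma pow_div_factorial_mul_rpow_le {r β : ℝ} {k : ℕ} (hr : 0 < r) (hβ : 0 ≤ β) (hk : β ≤ k)
    (n : ℕ) :
    r ^ n / n.factorial * (r / (n + 1)) ^ β ≤
      r ^ n / n.factorial + k.factorial * (r ^ (n + k) / (n + k).factorial) := by
  have hfac : ((n + k).factorial : ℝ) ≤ k.factorial * n.factorial * (n + 1) ^ k := by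
    have h := Nat.ascFactorial_le_factorial_mul_pow (n + 1) k
    have h' := Nat.mul_le_mul_left n.factorial h
    rw [Nat.factorial_mul_ascFactorial] at h'
    calc ((n + k).factorial : ℝ) ≤ (n.factorial * (k.factorial * (n + 1) ^ k) : ℕ) := by
          exact_mod_cast h'
      _ = _ := by push_cast; ring
  have hpow : r ^ n / n.factorial * (r / (n + 1)) ^ k ≤
      k.factorial * (r ^ (n + k) / (n + k).factorial) := by
    rw [div_pow, div_mul_div_comm, ← pow_add, ← mul_div_assoc,
      div_le_div_iff₀ (by positivity) (by positivity)]
    calc r ^ (n + k) * (n + k).factorial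
        ≤ r ^ (n + k) * (k.factorial * n.factorial * (n + 1) ^ k) := by gcongr
      _ = _ := by ring
  calc r ^ n / n.factorial * (r / (n + 1)) ^ β
      ≤ r ^ n / n.factorial * (1 + (r / (n + 1)) ^ k) := by
        gcongr
        exact rpow_le_one_add_pow (by positivity) hβ hk
    _ ≤ _ := by rw [mul_add, mul_one]; gcongr

/-- The largest term of the exponential series at `r` is `O(e^r / √r)`. -/
lemma pow_div_factorial_mul_rpow_half_le {r : ℝ} (hr : 0 < r) (n : ℕ) :
    r ^ n / n.factorial * r ^ (1/2 : ℝ) ≤ Real.exp 1 * Real.exp r := by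
  rw [← Real.exp_add, ← Real.log_le_iff_le_exp (by positivity),
    Real.log_mul (by positivity) (by positivity), Real.log_div (by positivity) (by positivity),
    Real.log_pow, Real.log_rpow hr]
  rcases Nat.eq_zero_or_pos n with rfl | hn
  · have := Real.log_le_sub_one_of_pos hr
    simp
    linarith
  · have hS := Stirling.le_log_factorial_stirling hn.ne'
    have hn1 : (1 : ℝ) ≤ n := by exact_mod_cast hn
    have hn0 : (0 : ℝ) < n := by linarith
    have hx : (0 : ℝ) < n + 1/2 := by linarith
    have h1 := Real.log_le_sub_one_of_pos (div_pos hr hx)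
    have h2 := Real.log_le_sub_one_of_pos (div_pos hx hn0)
    rw [Real.log_div hr.ne' hx.ne'] at h1
    rw [Real.log_div hx.ne' hn0.ne'] at h2
    have h3 : 0 ≤ Real.log (2 * Real.pi) :=
      Real.log_nonneg (by linarith [Real.pi_gt_three])
    have h4 := mul_le_mul_of_nonneg_left (add_le_add h1 h2) hx.le
    have h5 : ((n : ℝ) + 1/2) * (r / (n + 1/2) - 1 + ((n + 1/2) / n - 1)) =
        r - n + 1 / (4 * n) := by
      field_simp
      ring
    have h6 : 1 / (4 * (n : ℝ)) ≤ 1 := by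
      rw [div_le_one (by positivity)]
      linarith
    rw [h5] at h4
    linarith

lemma summable_pow_add_div_factorial (r : ℝ) (k : ℕ) :
    Summable (fun n : ℕ => r ^ (n + k) / ((n + k).factorial : ℝ)) :=
  (summable_nat_add_iff k (f := fun n : ℕ => r ^ n / (n.factorial : ℝ))).2
    (Real.summable_pow_div_factorial r)

lemma tsum_pow_add_div_factorial_le {r : ℝ} (hr : 0 < r) (k : ℕ) :
    ∑' n : ℕ, r ^ (n + k) / ((n + k).factorial : ℝ) ≤ Real.exp r := by
  have hs := (Real.summable_pow_div_factorial r).sum_add_tsum_nat_add k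
  have he : Real.exp r = ∑' n : ℕ, r ^ n / (n.factorial : ℝ) := by
    rw [Real.exp_eq_exp_ℝ]
    exact (NormedSpace.expSeries_div_hasSum_exp r).tsum_eq.symm
  have h0 : 0 ≤ ∑ i ∈ Finset.range k, r ^ i / (i.factorial : ℝ) :=
    Finset.sum_nonneg fun i _ => by positivity
  rw [he]
  linarith

lemma exists_pow_div_dunklD_mul_rpow_le (α : ℝ) (hα : -1/2 < α) :
    ∃ C : ℝ, 0 < C ∧ ∃ k : ℕ, ∀ r : ℝ, 0 < r → ∀ n : ℕ,
      r ^ n / dunklD α n * r ^ (α + 1/2) ≤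
        C * (r ^ n / n.factorial + k.factorial * (r ^ (n + k) / (n + k).factorial)) := by
  obtain ⟨c, hc, h⟩ := exists_factorial_mul_rpow_le_dunklD α hα
  obtain ⟨k, hk⟩ := exists_nat_ge (α + 1/2)
  refine ⟨c⁻¹, by positivity, k, fun r hr n => ?_⟩
  calc r ^ n / dunklD α n * r ^ (α + 1/2)
      ≤ r ^ n / (c * (n.factorial * (n + 1) ^ (α + 1/2))) * r ^ (α + 1/2) := by
        gcongr
        exact h n
    _ = c⁻¹ * (r ^ n / n.factorial * (r / (n + 1)) ^ (α + 1/2)) := by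
        rw [Real.div_rpow hr.le (by positivity)]
        field_simp
    _ ≤ _ := by
        gcongr
        exact pow_div_factorial_mul_rpow_le hr (by linarith) hk n

lemma exists_summable_and_tsum_le_and_sup_le (α : ℝ) (hα : -1/2 < α) :
    ∃ C : ℝ, 0 < C ∧ ∀ r : ℝ, 0 < r →
      Summable (fun n : ℕ => r ^ n / dunklD α n) ∧
      ∑' n : ℕ, r ^ n / dunklD α n ≤ C * (Real.exp r / r ^ (α + 1/2)) ∧
      ∀ n : ℕ, r ^ n / dunklD α n ≤ C * (Real.exp r / r ^ (α + 1)) := by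
  obtain ⟨C, hC, k, h⟩ := exists_pow_div_dunklD_mul_rpow_le α hα
  have he : 1 ≤ Real.exp 1 := Real.one_le_exp zero_le_one
  refine ⟨C * (1 + k.factorial) * Real.exp 1, by positivity, fun r hr => ?_⟩
  have hrβ : 0 < r ^ (α + 1/2) := by positivity
  have hterm (n : ℕ) : r ^ n / dunklD α n ≤ C / r ^ (α + 1/2) *
      (r ^ n / n.factorial + k.factorial * (r ^ (n + k) / (n + k).factorial)) := by
    rw [div_mul_eq_mul_div, le_div_iff₀ hrβ]
    exact h r hr n
  have hs0 := Real.summable_pow_div_factorial r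
  have hsk := (summable_pow_add_div_factorial r k).mul_left (k.factorial : ℝ)
  have hsum := (hs0.add hsk).mul_left (C / r ^ (α + 1/2))
  have hS : Summable (fun n : ℕ => r ^ n / dunklD α n) :=
    hsum.of_nonneg_of_le (fun n => (div_pos (pow_pos hr n) (dunklD_pos α hα n)).le) hterm
  refine ⟨hS, ?_, fun n => ?_⟩
  · have hle := hS.tsum_le_tsum hterm hsum
    rw [tsum_mul_left, hs0.tsum_add hsk, tsum_mul_left] at hle
    have e0 : ∑' n : ℕ, r ^ n / (n.factorial : ℝ) ≤ Real.exp r := by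
      simpa using tsum_pow_add_div_factorial_le hr 0
    have ek := tsum_pow_add_div_factorial_le hr k
    calc _ ≤ C / r ^ (α + 1/2) * (Real.exp r + k.factorial * Real.exp r) := by
          refine hle.trans ?_
          gcongr
      _ = C * (1 + k.factorial) * 1 * (Real.exp r / r ^ (α + 1/2)) := by ring
      _ ≤ _ := by gcongr
  · have hr2 : 0 < r ^ (1/2 : ℝ) := by positivity
    have e0 := pow_div_factorial_mul_rpow_half_le hr n
    have ek := pow_div_factorial_mul_rpow_half_le hr (n + k)
    rw [← le_div_iff₀ hr2] at e0 ek
    have hpow : r ^ (α + 1) = r ^ (α + 1/2) * r ^ (1/2 : ℝ) := by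
      rw [← Real.rpow_add hr]
      ring_nf
    calc _ ≤ C / r ^ (α + 1/2) * (Real.exp 1 * Real.exp r / r ^ (1/2 : ℝ) +
          k.factorial * (Real.exp 1 * Real.exp r / r ^ (1/2 : ℝ))) := by
          refine (hterm n).trans ?_
          gcongr
      _ = _ := by
          rw [hpow]
          field_simp

/-- For `1 ≤ q ≤ 2` and `p` the conjugate exponent of `q` (so that `1/(2p) = (1 - 1/q)/2`,
with the convention `1/(2p) = 0` when `p = ∞`, i.e. `q = 1`), there is `C > 0` such that
`Σ_{n=0}^∞ r^(qn)/(d_n(α))^q ≤ C (e^r / r^(α + 1/2 + 1/(2p)))^q` for all `r > 0`. -/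
theorem dunklD_sum_estimate (α : ℝ) (hα : -1/2 < α) (q : ℝ) (hq1 : 1 ≤ q) (hq2 : q ≤ 2) :
    ∃ C : ℝ, 0 < C ∧ ∀ r : ℝ, 0 < r →
      Summable (fun n : ℕ => r ^ (q * n) / dunklD α n ^ q) ∧
      (∑' n : ℕ, r ^ (q * n) / dunklD α n ^ q) ≤
        C * (Real.exp r / r ^ (α + 1/2 + (1 - 1/q)/2)) ^ q := by
  obtain ⟨C, hC, h⟩ := exists_summable_and_tsum_le_and_sup_le α hα
  refine ⟨C ^ (q - 1) * C, by positivity, fun r hr => ?_⟩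
  obtain ⟨hS, hsum, hsup⟩ := h r hr
  have hq : 0 ≤ q - 1 := by linarith
  set M := C * (Real.exp r / r ^ (α + 1)) with hM
  have ha (n : ℕ) : 0 < r ^ n / dunklD α n := div_pos (pow_pos hr n) (dunklD_pos α hα n)
  have hterm (n : ℕ) : r ^ (q * n) / dunklD α n ^ q = (r ^ n / dunklD α n) ^ q := by
    rw [Real.div_rpow (by positivity) (dunklD_pos α hα n).le, mul_comm q, Real.rpow_mul hr.le,
      Real.rpow_natCast]
  have hle (n : ℕ) : r ^ (q * n) / dunklD α n ^ q ≤ M ^ (q - 1) * (r ^ n / dunklD α n) := by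
    rw [hterm, show q = q - 1 + 1 by ring, Real.rpow_add_one (ha n).ne', add_sub_cancel_right]
    have := ha n
    gcongr
    exact hsup n
  have hSM := hS.mul_left (M ^ (q - 1))
  have hSq : Summable (fun n : ℕ => r ^ (q * n) / dunklD α n ^ q) :=
    hSM.of_nonneg_of_le (fun n => by rw [hterm]; exact Real.rpow_nonneg (ha n).le q) hle
  refine ⟨hSq, ?_⟩
  have hexp : r ^ (α + 1/2 + (1 - 1/q)/2) = r ^ ((α + 1) * (q - 1) / q) * r ^ ((α + 1/2) / q) := by
    rw [← Real.rpow_add hr]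
    congr 1
    field_simp
    ring
  have hfinal : (Real.exp r / r ^ (α + 1)) ^ (q - 1) * (Real.exp r / r ^ (α + 1/2)) =
      (Real.exp r / r ^ (α + 1/2 + (1 - 1/q)/2)) ^ q := by
    have hq0 : q ≠ 0 := by linarith
    rw [Real.div_rpow (by positivity) (by positivity), Real.div_rpow (by positivity) (by positivity),
      hexp, Real.mul_rpow (by positivity) (by positivity), ← Real.rpow_mul hr.le,
      ← Real.rpow_mul hr.le, ← Real.rpow_mul hr.le, div_mul_cancel₀ _ hq0, div_mul_cancel₀ _ hq0,
      div_mul_div_comm, ← Real.rpow_add_one (Real.exp_ne_zero r), sub_add_cancel]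
  calc _ ≤ M ^ (q - 1) * ∑' n : ℕ, r ^ n / dunklD α n := by
        rw [← tsum_mul_left]
        exact hSq.tsum_le_tsum hle hSM
    _ ≤ M ^ (q - 1) * (C * (Real.exp r / r ^ (α + 1/2))) := by gcongr
    _ = _ := by
        rw [← hfinal, hM, Real.mul_rpow hC.le (by positivity)]
        ring
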